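/- Every finite open cover of the decomposition space D admits a finite open refinement which covers D and has no nonempty triple intersections: any three pairwise distinct members of the refinement have empty intersection. -/

import Mathlib

open scoped BigOperators

namespace DecompPaper

variable (B : Type) [DecidableEq B]

/-- The set of letters `B ⊔ B⁻¹` carries the discrete topology. -/
instance : TopologicalSpace (B × Bool) := ⊥

/-- The Gromov boundary `∂F` of the free group on `B`: the space of infinite reduced
words, i.e. sequences of letters with no cancelling adjacent pair, topologized as a
subspace of the product of discrete spaces. -/
abbrev Boundary : Type :=
  {s : ℕ → B × Bool // ∀ k, s (k + 1) ≠ ((s k).1, !(s k).2)}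

/-- The prefix of length `m` of an infinite reduced word, as an element of the free group. -/
def prefixOf (ξ : Boundary B) (m : ℕ) : FreeGroup B :=
  FreeGroup.mk (List.ofFn fun i : Fin m => ξ.1 i)

/-- Adjacency in the Cayley graph `T` of the free group with respect to `B`. -/
def Adj (g h : FreeGroup B) : Prop :=
  ∃ x : B × Bool, h = g * FreeGroup.mk [x]

/-- A set of vertices of `T` is a subtree iff any two of its vertices are joined by a
path in the Cayley graph staying inside the set. -/
def IsSubtree (X : Set (FreeGroup B)) : Prop :=
  ∀ g ∈ X, ∀ h ∈ X, Relation.ReflTransGen (fun a b => Adj B a b ∧ b ∈ X) g h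

/-- `C` is a connected component of `T ∖ X`. -/
def IsComponentOf (X C : Set (FreeGroup B)) : Prop :=
  ∃ v, v ∉ X ∧
    C = {u | Relation.ReflTransGen (fun a b => Adj B a b ∧ a ∉ X ∧ b ∉ X) v u}

/-- `∂C`: the set of boundary points all of whose sufficiently long prefixes lie in `C`. -/
def boundaryOf (C : Set (FreeGroup B)) : Set (Boundary B) :=
  {ξ | ∃ m, ∀ k, m ≤ k → prefixOf B ξ k ∈ C}

/-- The sequence `a` of group elements converges to the boundary point `ξ`:
every prefix of `ξ` is eventually an initial segment of the reduced word of `a k`. -/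
def TendstoBoundary (a : ℕ → FreeGroup B) (ξ : Boundary B) : Prop :=
  ∀ m : ℕ, ∃ K, ∀ k, K ≤ k → (List.ofFn fun i : Fin m => ξ.1 i) <+: (a k).toWord

/-- `{ξ, η}` is a line of the line pattern generated by the words `w i`: for some
`g` and `i`, `ξ` and `η` are the limits of `g * (w i) ^ k` as `k → +∞` and `k → -∞`
(in one of the two orders). -/
def IsLine {r : ℕ} (w : Fin r → FreeGroup B) (ξ η : Boundary B) : Prop :=
  ∃ (g : FreeGroup B) (i : Fin r),
    (TendstoBoundary B (fun k => g * w i ^ k) ξ ∧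
       TendstoBoundary B (fun k => g * (w i)⁻¹ ^ k) η) ∨
    (TendstoBoundary B (fun k => g * w i ^ k) η ∧
       TendstoBoundary B (fun k => g * (w i)⁻¹ ^ k) ξ)

/-- Malnormality of the family of cyclic subgroups `⟨w i⟩`. -/
def Malnormal {r : ℕ} (w : Fin r → FreeGroup B) : Prop :=
  ∀ (g : FreeGroup B) (i j : Fin r),
    (∃ x : FreeGroup B, x ∈ Subgroup.zpowers (w i) ∧ x ≠ 1 ∧
        g * x * g⁻¹ ∈ Subgroup.zpowers (w j)) →
      i = j ∧ g ∈ Subgroup.zpowers (w i)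

/-- The decomposition space `D`: the quotient of `∂F` by the smallest equivalence
relation identifying the two endpoints of each line, with the quotient topology. -/
abbrev DSpace {r : ℕ} (w : Fin r → FreeGroup B) : Type :=
  Quot (IsLine B w)

/-- The quotient projection `q : ∂F → D`. -/
def qmap {r : ℕ} (w : Fin r → FreeGroup B) : Boundary B → DSpace B w :=
  Quot.mk _

/-- The geodesic of the line with endpoints `ξ` and `η`: all prefixes of `ξ` or of `η`
of length at least the length of their longest common initial segment. -/
def lineGeodesic (ξ η : Boundary B) : Set (FreeGroup B) :=
  {g | ∃ k : ℕ, (g = prefixOf B ξ k ∨ g = prefixOf B η k) ∧ ∃ i ≤ k, ξ.1 i ≠ η.1 i}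

/-- The line with endpoints `ξ, η` passes through the subtree `X`. -/
def PassesThrough (ξ η : Boundary B) (X : Set (FreeGroup B)) : Prop :=
  ∃ g ∈ X, g ∈ lineGeodesic B ξ η

/-- A function `σ : D → ℤ` is supported on the subtree `X` if `σ ∘ q` is constant on
`∂C` for every connected component `C` of `T ∖ X`. -/
def SupportedOn {r : ℕ} (w : Fin r → FreeGroup B) (σ : DSpace B w → ℤ)
    (X : Set (FreeGroup B)) : Prop :=
  ∀ C : Set (FreeGroup B), IsComponentOf B X C →
    ∀ ξ, ξ ∈ boundaryOf B C → ∀ η, η ∈ boundaryOf B C →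
      σ (qmap B w ξ) = σ (qmap B w η)

/-- Prepending a letter to an infinite reduced word, cancelling if necessary. -/
def consB (x : B × Bool) (ξ : Boundary B) : Boundary B :=
  if h : ξ.1 0 = (x.1, !x.2) then
    ⟨fun k => ξ.1 (k + 1), fun k => ξ.2 (k + 1)⟩
  else
    ⟨fun k => Nat.rec x (fun j _ => ξ.1 j) k, by
      intro k
      cases k with
      | zero => exact h
      | succ j => exact ξ.2 j⟩

/-- The action of the free group on its boundary: left multiplication followed by
reduction. -/
def actB (g : FreeGroup B) (ξ : Boundary B) : Boundary B :=
  g.toWord.foldr (consB B) ξ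

/-- The induced action of the free group on the decomposition space. -/
noncomputable def actD {r : ℕ} (w : Fin r → FreeGroup B) (g : FreeGroup B)
    (x : DSpace B w) : DSpace B w :=
  qmap B w (actB B g (Quot.out x))

/-- The map `p : (ℤ[F])^k → C(D, ℤ)` of right `ℤ[F]`-modules determined by generators
`σ j`, where an element of the free module `(ℤ[F])^k` is recorded as a finitely
supported function `(Fin k × F) →₀ ℤ` and `e_j · g` is sent to `σ j · g`. -/
noncomputable def pMap {r : ℕ} (w : Fin r → FreeGroup B) {k : ℕ}
    (σ : Fin k → DSpace B w → ℤ) (x : (Fin k × FreeGroup B) →₀ ℤ) :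
    DSpace B w → ℤ :=
  fun d => x.sum fun p n => n * σ p.1 (actD B w p.2 d)

/-- Right translation by `g` on the free module `(ℤ[F])^k`, sending `e_j · h` to
`e_j · (h * g)`. -/
noncomputable def fsTranslate {k : ℕ} (y : (Fin k × FreeGroup B) →₀ ℤ)
    (g : FreeGroup B) : (Fin k × FreeGroup B) →₀ ℤ :=
  Finsupp.mapDomain (fun p => (p.1, p.2 * g)) y

/-- The convex hull of a set of vertices of `T`: the smallest subtree containing it. -/
def hull (S : Set (FreeGroup B)) : Set (FreeGroup B) :=
  ⋂₀ {Y : Set (FreeGroup B) | IsSubtree B Y ∧ S ⊆ Y}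

/-- The support of an element of the free module `(ℤ[F])^k`, relative to supports
`X j` of the generators: the convex hull of the union of the sets `g⁻¹ • X j` over
the pairs `(j, g)` appearing with nonzero coefficient. -/
def fsSupport {k : ℕ} (X : Fin k → Set (FreeGroup B))
    (x : (Fin k × FreeGroup B) →₀ ℤ) : Set (FreeGroup B) :=
  hull B (⋃ p ∈ x.support, (fun v => p.2⁻¹ * v) '' X p.1)

/-- Antisymmetry of a `1`-cochain on oriented lines. -/
def Antisym {r : ℕ} (w : Fin r → FreeGroup B)
    (f : Boundary B → Boundary B → ℤ) : Prop :=
  ∀ ξ η, IsLine B w ξ η → f η ξ = -f ξ η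

/-- A `1`-cochain is supported on the subtree `X`: it vanishes on lines not passing
through `X`, and depends only on the pair of components of `T ∖ X` containing the two
endpoints. -/
def SupportedOn1 {r : ℕ} (w : Fin r → FreeGroup B)
    (f : Boundary B → Boundary B → ℤ) (X : Set (FreeGroup B)) : Prop :=
  (∀ ξ η, IsLine B w ξ η → ¬PassesThrough B ξ η X → f ξ η = 0) ∧
  (∀ C C' : Set (FreeGroup B), IsComponentOf B X C → IsComponentOf B X C' → C ≠ C' →
    ∀ ξ ξ' η η', IsLine B w ξ η → IsLine B w ξ' η' →
      ξ ∈ boundaryOf B C → ξ' ∈ boundaryOf B C →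
      η ∈ boundaryOf B C' → η' ∈ boundaryOf B C' →
      f ξ η = f ξ' η')

/-- Membership in `C¹`: an antisymmetric integer-valued function on oriented lines
supported on at least one finite nonempty subtree of `T`. -/
def MemC1 {r : ℕ} (w : Fin r → FreeGroup B)
    (f : Boundary B → Boundary B → ℤ) : Prop :=
  Antisym B w f ∧
    ∃ X : Set (FreeGroup B), X.Finite ∧ X.Nonempty ∧ IsSubtree B X ∧
      SupportedOn1 B w f X

/-- The ball of radius `R` about a set `Y` of vertices of `T` (word metric). -/
def ballAbout (Y : Set (FreeGroup B)) (R : ℕ) : Set (FreeGroup B) :=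
  {g | ∃ y ∈ Y, (y⁻¹ * g).toWord.length ≤ R}

/-- The map `p : (ℤ[F])^k → C¹` of right `ℤ[F]`-modules determined by generators
`f j`, sending `e_j · g` to `f j · g`. -/
noncomputable def pC1 {k : ℕ} (f : Fin k → Boundary B → Boundary B → ℤ)
    (x : (Fin k × FreeGroup B) →₀ ℤ) : Boundary B → Boundary B → ℤ :=
  fun ξ η => x.sum fun p n => n * f p.1 (actB B p.2 ξ) (actB B p.2 η)

/-- `σ : ∂F → ℤ` is constant on `∂C` for every connected component `C` of `T ∖ X`. -/
def ConstOnComponents (X : Set (FreeGroup B)) (σ : Boundary B → ℤ) : Prop :=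
  ∀ C : Set (FreeGroup B), IsComponentOf B X C →
    ∀ ξ, ξ ∈ boundaryOf B C → ∀ η, η ∈ boundaryOf B C → σ ξ = σ η

/-- The shadow `S(g) ⊆ ∂F` of a nontrivial group element `g`: the boundary points
having the reduced word of `g` as an initial segment. -/
def shadow (g : FreeGroup B) : Set (Boundary B) :=
  {ξ | prefixOf B ξ g.toWord.length = g}

end DecompPaper

section Topology

open Set TopologicalSpace

/-- A finite family of closed sets in a normal space has open neighbourhoods with the same
nerve. -/
theorem exists_isOpen_swelling {X ι : Type*} [TopologicalSpace X] [NormalSpace X] [Finite ι]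
    {F : ι → Set X} (hF : ∀ i, IsClosed (F i)) :
    ∃ U : ι → Set X, (∀ i, IsOpen (U i)) ∧ (∀ i, F i ⊆ U i) ∧
      ∀ T : Set ι, ⋂ i ∈ T, F i = ∅ → ⋂ i ∈ T, U i = ∅ := by
  have key : ∀ T : Set ι, ∃ U : ι → Set X, (∀ i, IsOpen (U i)) ∧ (∀ i, F i ⊆ U i) ∧
      (⋂ i ∈ T, F i = ∅ → ⋂ i ∈ T, U i = ∅) := by
    intro T
    by_cases hT : ⋂ i ∈ T, F i = ∅
    · obtain ⟨v, hv, -, hvF⟩ := exists_iUnion_eq_closure_subset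
        (u := fun i : T => (F i)ᶜ) (fun i => (hF i).isOpen_compl) (fun _ => Set.toFinite _)
        (by rw [← compl_iInter, ← biInter_eq_iInter T (fun i _ => F i), hT, compl_empty])
      refine ⟨fun i => ⋂ h : i ∈ T, (closure (v ⟨i, h⟩))ᶜ,
        fun i => isOpen_iInter_of_finite fun h => isClosed_closure.isOpen_compl,
        fun i => subset_iInter fun h => subset_compl_comm.1 (hvF ⟨i, h⟩), fun _ => ?_⟩
      refine eq_empty_iff_forall_notMem.2 fun x hx => ?_
      obtain ⟨i, hi⟩ := mem_iUnion.1 (hv ▸ mem_univ x)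
      have := mem_iInter₂.1 hx i i.2
      exact mem_iInter.1 this i.2 (subset_closure hi)
    · exact ⟨fun _ => univ, fun _ => isOpen_univ, fun _ => subset_univ _, fun h => (hT h).elim⟩
  choose U hUo hUF hU using key
  refine ⟨fun i => ⋂ T, U T i, fun i => isOpen_iInter_of_finite fun T => hUo T i,
    fun i => subset_iInter fun T => hUF T i, fun T hT => ?_⟩
  refine subset_empty_iff.1 ((hU T hT).le.trans' ?_)
  exact iInter₂_mono fun i _ => iInter_subset _ T

/-- The image of a normal space under a continuous closed surjection is normal. -/
theorem IsClosedMap.normalSpace_of_surjective {X Y : Type*} [TopologicalSpace X]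
    [TopologicalSpace Y] [NormalSpace X] {f : X → Y} (hf : IsClosedMap f) (hc : Continuous f)
    (hs : Function.Surjective f) : NormalSpace Y := by
  refine ⟨fun s t hs' ht hst => ?_⟩
  obtain ⟨u, v, hu, hv, hsu, htv, huv⟩ := normal_separation (hs'.preimage hc) (ht.preimage hc)
    (hst.preimage f)
  refine ⟨(f '' uᶜ)ᶜ, (f '' vᶜ)ᶜ, (hf _ hu.isClosed_compl).isOpen_compl,
    (hf _ hv.isClosed_compl).isOpen_compl, ?_, ?_, ?_⟩
  · rintro _ hy ⟨x, hx, rfl⟩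
    exact hx (hsu hy)
  · rintro _ hy ⟨x, hx, rfl⟩
    exact hx (htv hy)
  · refine disjoint_left.2 fun y hy hy' => ?_
    obtain ⟨x, rfl⟩ := hs y
    have hxu : x ∈ u := by_contra fun h => hy ⟨x, h, rfl⟩
    have hxv : x ∈ v := by_contra fun h => hy' ⟨x, h, rfl⟩
    exact disjoint_left.1 huv hxu hxv

/-- The quotient map of a compact space by a closed relation is closed. -/
theorem isClosedMap_of_isClosed_ker {X Y : Type*} [TopologicalSpace X] [CompactSpace X]
    [TopologicalSpace Y] {f : X → Y} (hf : Topology.IsQuotientMap f)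
    (hR : IsClosed {p : X × X | f p.1 = f p.2}) : IsClosedMap f := by
  intro s hs
  rw [← hf.isClosed_preimage]
  have : f ⁻¹' (f '' s) = Prod.snd '' ({p : X × X | f p.1 = f p.2} ∩ Prod.fst ⁻¹' s) := by
    ext y
    constructor
    · rintro ⟨x, hx, hxy⟩
      exact ⟨(x, y), ⟨hxy, hx⟩, rfl⟩
    · rintro ⟨⟨x, y⟩, ⟨hxy, hx⟩, rfl⟩
      exact ⟨x, hx, hxy⟩
  rw [this]
  exact isClosedMap_snd_of_compactSpace _ (hR.inter (hs.preimage continuous_fst))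

/-- A closed continuous image of a profinite space with fibres of at most two points has covering
dimension at most one. -/
theorem exists_refinement_of_isClosedMap {X Y : Type*} [TopologicalSpace X] [CompactSpace X]
    [T2Space X] [TotallyDisconnectedSpace X] [TopologicalSpace Y] {f : X → Y}
    (hf : IsClosedMap f) (hc : Continuous f) (hs : Function.Surjective f)
    (hfib : ∀ x y z, f x = f y → f y = f z → x = y ∨ y = z ∨ x = z)
    (W : Set (Set Y)) (hWopen : ∀ V ∈ W, IsOpen V) (hWcov : ⋃₀ W = univ) :
    ∃ V : Set (Set Y), V.Finite ∧ (∀ u ∈ V, IsOpen u) ∧ ⋃₀ V = univ ∧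
      (∀ u ∈ V, ∃ s ∈ W, u ⊆ s) ∧
      (∀ u ∈ V, ∀ v ∈ V, ∀ t ∈ V, u ≠ v → v ≠ t → u ≠ t → u ∩ v ∩ t = ∅) := by
  have := hf.normalSpace_of_surjective hc hs
  let O : W → Opens X := fun s => ⟨f ⁻¹' s.1, (hWopen _ s.2).preimage hc⟩
  have hO : IsOpenCover O := by
    refine IsOpenCover.mk ?_
    ext x
    obtain ⟨s, hs, hx⟩ := mem_sUnion.1 (hWcov ▸ mem_univ (f x))
    simpa [O] using ⟨s, hs, hx⟩
  obtain ⟨n, P, hP, hPcov, hPd⟩ := hO.exists_finite_nonempty_disjoint_clopen_cover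
  choose s hPs using fun j => (hP j).2
  obtain ⟨U, hUo, hFU, hU⟩ := exists_isOpen_swelling (F := fun j => f '' (P j : Set X))
    fun j => hf _ (P j).isClopen.isClosed
  refine ⟨range fun j => U j ∩ (s j : Set Y), finite_range _, ?_, ?_, ?_, ?_⟩
  · rintro _ ⟨j, rfl⟩
    exact (hUo j).inter (hWopen _ (s j).2)
  · refine eq_univ_of_forall fun y => ?_
    obtain ⟨x, rfl⟩ := hs y
    obtain ⟨j, hj⟩ := mem_iUnion.1 (hPcov (mem_univ x))
    exact ⟨_, ⟨j, rfl⟩, hFU j ⟨x, hj, rfl⟩, hPs j hj⟩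
  · rintro _ ⟨j, rfl⟩
    exact ⟨s j, (s j).2, inter_subset_right⟩
  · rintro _ ⟨i, rfl⟩ _ ⟨j, rfl⟩ _ ⟨k, rfl⟩ hij hjk hik
    have hne : ∀ {a b : Fin n}, U a ∩ (s a : Set Y) ≠ U b ∩ (s b : Set Y) →
        ∀ {x}, x ∈ P a → x ∉ P b := by
      intro a b hab x hxa hxb
      have hab' : a ≠ b := by
        rintro rfl
        exact hab rfl
      exact disjoint_left.1 (Clopens.coe_disjoint.2 (hPd hab')) hxa hxb
    have hT := hU {i, j, k} (eq_empty_iff_forall_notMem.2 fun y hy => by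
      simp only [mem_insert_iff, mem_singleton_iff, iInter_iInter_eq_or_left,
        iInter_iInter_eq_left, mem_inter_iff] at hy
      obtain ⟨⟨x, hx, rfl⟩, ⟨x', hx', h'⟩, ⟨x'', hx'', h''⟩⟩ := hy
      rcases hfib x x' x'' h'.symm (h'.trans h''.symm) with rfl | rfl | rfl
      · exact hne hij hx hx'
      · exact hne hjk hx' hx''
      · exact hne hik hx hx'')
    refine subset_empty_iff.1 (hT.le.trans' ?_)
    rintro y ⟨⟨⟨hi, -⟩, ⟨hj, -⟩⟩, ⟨hk, -⟩⟩
    simp [hi, hj, hk]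

end Topology

namespace DecompPaper

section FreeGroup

variable {B : Type} [DecidableEq B]

/-- Multiplying on the right by a letter either appends it or deletes the last letter. -/
theorem toWord_mul_mk_singleton (b : FreeGroup B) (x : B × Bool) :
    (b * FreeGroup.mk [x]).toWord = b.toWord ++ [x] ∨
      (b * FreeGroup.mk [x]).toWord = b.toWord.dropLast := by
  have hred : FreeGroup.IsReduced b.toWord := FreeGroup.isReduced_toWord
  have hb : b = FreeGroup.mk b.toWord := FreeGroup.mk_toWord.symm
  by_cases h : FreeGroup.IsReduced (b.toWord ++ [x])
  · left
    conv_lhs => rw [hb]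
    rw [FreeGroup.mul_mk, FreeGroup.toWord_mk, h.reduce_eq]
  · right
    rcases List.eq_nil_or_concat b.toWord with hnil | ⟨L, y, hL⟩
    · rw [hnil] at h
      exact (h FreeGroup.IsReduced.singleton).elim
    · rw [List.concat_eq_append] at hL
      have hxy : ¬ (y.1 = x.1 → y.2 = x.2) := fun hxy => h (by
        rw [hL]
        refine FreeGroup.IsReduced.append_overlap (hL ▸ hred) ?_ (by simp)
        simpa [FreeGroup.IsReduced] using hxy)
      have hLred : FreeGroup.IsReduced L :=
        (List.isChain_append.1 (hL ▸ hred)).1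
      conv_lhs => rw [hb]
      rw [FreeGroup.mul_mk, FreeGroup.toWord_mk, hL, List.dropLast_concat]
      obtain ⟨x₁, x₂⟩ := x
      obtain ⟨y₁, y₂⟩ := y
      have hx : x₁ = y₁ ∧ x₂ = !y₂ := by
        simp only [Classical.not_imp] at hxy
        refine ⟨hxy.1.symm, ?_⟩
        have := hxy.2
        revert this
        cases x₂ <;> cases y₂ <;> simp
      obtain ⟨rfl, rfl⟩ := hx
      have hstep : FreeGroup.Red.Step (L ++ [(x₁, y₂)] ++ [(x₁, !y₂)]) L := by
        simpa using FreeGroup.Red.Step.not (L₁ := L) (L₂ := []) (x := x₁) (b := y₂)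
      rw [FreeGroup.reduce.Step.eq hstep, hLred.reduce_eq]

/-- Multiplying on the right by a short word preserves short prefixes. -/
theorem prefix_toWord_mul_mk {p : List (B × Bool)} (L : List (B × Bool)) :
    ∀ b : FreeGroup B, p <+: b.toWord → p.length + L.length ≤ b.toWord.length →
      p <+: (b * FreeGroup.mk L).toWord := by
  induction L with
  | nil =>
    intro b hp _
    simpa [← FreeGroup.one_eq_mk] using hp
  | cons x L ih =>
    intro b hp hlen
    rw [List.length_cons] at hlen
    have hmul : b * FreeGroup.mk (x :: L) = b * FreeGroup.mk [x] * FreeGroup.mk L := by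
      rw [mul_assoc, FreeGroup.mul_mk, List.singleton_append]
    rw [hmul]
    rcases toWord_mul_mk_singleton b x with h | h
    · refine ih _ ?_ ?_
      · rw [h]
        exact hp.trans (List.prefix_append _ _)
      · rw [h, List.length_append]
        omega
    · refine ih _ ?_ ?_
      · rw [h]
        refine List.prefix_of_prefix_length_le hp (List.dropLast_prefix _) ?_
        rw [List.length_dropLast]
        omega
      · rw [h, List.length_dropLast]
        omega

/-- If `p` is a prefix of `b` but not of `a`, then the geodesic from `a` to `b` passes
through `p`. -/
theorem norm_le_of_prefix_toWord {p : List (B × Bool)} {a b : FreeGroup B}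
    (hb : p <+: b.toWord) (ha : ¬ p <+: a.toWord) :
    b.norm ≤ p.length + (a⁻¹ * b).norm := by
  by_contra! h
  refine ha ?_
  have := prefix_toWord_mul_mk (b⁻¹ * a).toWord b hb (by
    have hn : (b⁻¹ * a).norm = (a⁻¹ * b).norm := by
      rw [← FreeGroup.norm_inv_eq, mul_inv_rev, inv_inv]
    change p.length + (b⁻¹ * a).norm ≤ b.norm
    omega)
  rwa [FreeGroup.mk_toWord, mul_inv_cancel_left] at this

/-- If `p` is a prefix of `b`, then the distance from `p` to `b` is the difference of lengths. -/
theorem norm_inv_mk_mul_le {p : List (B × Bool)} {b : FreeGroup B} (hb : p <+: b.toWord) :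
    p.length + ((FreeGroup.mk p)⁻¹ * b).norm ≤ b.norm := by
  obtain ⟨c, hc⟩ := hb
  have : (FreeGroup.mk p)⁻¹ * b = FreeGroup.mk c := by
    rw [inv_mul_eq_iff_eq_mul, FreeGroup.mul_mk, hc, FreeGroup.mk_toWord]
  rw [this]
  have h := FreeGroup.norm_mk_le (L₁ := c)
  have h' : b.norm = p.length + c.length := by
    rw [FreeGroup.norm, ← hc, List.length_append]
  omega

theorem finite_norm_le [Finite B] (N : ℕ) : {g : FreeGroup B | g.norm ≤ N}.Finite :=
  (List.finite_length_le (B × Bool) N).preimage FreeGroup.toWord_injective.injOn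

end FreeGroup

section Lines

variable {B : Type} [DecidableEq B]

theorem TendstoBoundary.eq {a : ℕ → FreeGroup B} {ξ η : Boundary B}
    (hξ : TendstoBoundary B a ξ) (hη : TendstoBoundary B a η) : ξ = η := by
  refine Subtype.ext (funext fun n => ?_)
  obtain ⟨K, hK⟩ := hξ (n + 1)
  obtain ⟨K', hK'⟩ := hη (n + 1)
  have h := List.prefix_of_prefix_length_le (hK _ (le_max_left K K')) (hK' _ (le_max_right K K'))
    (by simp)
  have h' := h.eq_of_length (by simp)
  exact congrFun (List.ofFn_injective h') (Fin.last n)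

theorem TendstoBoundary.mul_zpow {g u : FreeGroup B} {ξ : Boundary B}
    (h : TendstoBoundary B (fun k => g * u ^ k) ξ) (c : ℤ) :
    TendstoBoundary B (fun k => g * u ^ c * u ^ k) ξ := by
  intro m
  obtain ⟨K, hK⟩ := h m
  refine ⟨K + c.natAbs, fun k hk => ?_⟩
  have := hK (c + k).toNat (by omega)
  have hcast : (((c + k).toNat : ℕ) : ℤ) = c + k := Int.toNat_of_nonneg (by omega)
  simp only [← zpow_natCast, hcast] at this
  simpa only [mul_assoc, ← zpow_natCast, ← zpow_add] using this

/-- Points of an orbit line `g u ^ k` converging to `ξ` come close to every prefix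
of `ξ` that is not a prefix of some point of the orbit line. -/
theorem TendstoBoundary.exists_near {g u : FreeGroup B} {ξ : Boundary B}
    (h : TendstoBoundary B (fun k => g * u ^ k) ξ) {m : ℕ} {c : ℤ}
    (hc : ¬ (List.ofFn fun i : Fin m => ξ.1 i) <+: (g * u ^ c).toWord) :
    ∃ k : ℤ, (List.ofFn fun i : Fin m => ξ.1 i) <+: (g * u ^ k).toWord ∧
      (g * u ^ k).norm ≤ m + u.norm := by
  classical
  obtain ⟨K, hK⟩ := h.mul_zpow c m
  have hex : ∃ k : ℕ, (List.ofFn fun i : Fin m => ξ.1 i) <+: (g * u ^ c * u ^ k).toWord :=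
    ⟨K, hK K le_rfl⟩
  obtain ⟨n, hn⟩ : ∃ n, Nat.find hex = n + 1 := by
    refine Nat.exists_eq_succ_of_ne_zero fun h0 => hc ?_
    simpa [h0] using Nat.find_spec hex
  have hspec := Nat.find_spec hex
  have hmin := Nat.find_min hex (m := n) (by omega)
  rw [hn] at hspec
  refine ⟨c + (n + 1 : ℕ), ?_, ?_⟩
  · simpa only [mul_assoc, ← zpow_natCast, ← zpow_add] using hspec
  · have := norm_le_of_prefix_toWord hspec hmin
    rw [List.length_ofFn, show (g * u ^ c * u ^ n)⁻¹ * (g * u ^ c * u ^ (n + 1)) = u by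
      rw [pow_succ]; group] at this
    simpa only [mul_assoc, ← zpow_natCast, ← zpow_add] using this

/-- Two orbit lines with a common limit point have commensurable translations. -/
theorem exists_conj_zpow_eq [Finite B] {g h u v : FreeGroup B} {ξ : Boundary B}
    (hu : TendstoBoundary B (fun k => g * u ^ k) ξ)
    (hv : TendstoBoundary B (fun k => h * v ^ k) ξ) :
    ∃ a b : ℤ, u ^ a ≠ 1 ∧ g * u ^ a * g⁻¹ = h * v ^ b * h⁻¹ := by
  have hnot : ∀ (x : FreeGroup B) (m : ℕ), x.norm < m →
      ¬ (List.ofFn fun i : Fin m => ξ.1 i) <+: x.toWord := by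
    intro x m hx hp
    have := hp.length_le
    rw [List.length_ofFn] at this
    exact absurd hx (not_lt.2 this)
  let M : ℕ → ℕ := fun t => g.norm + h.norm + 1 + (u.norm + 1) * t
  have hM : ∀ t, g.norm < M t ∧ h.norm < M t := by
    intro t
    simp only [M]
    omega
  have hk : ∀ t, ∃ k : ℤ, (List.ofFn fun i : Fin (M t) => ξ.1 i) <+: (g * u ^ k).toWord ∧
      (g * u ^ k).norm ≤ M t + u.norm := fun t =>
    hu.exists_near (c := 0) (by simpa using hnot g _ (hM t).1)
  have hl : ∀ t, ∃ l : ℤ, (List.ofFn fun i : Fin (M t) => ξ.1 i) <+: (h * v ^ l).toWord ∧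
      (h * v ^ l).norm ≤ M t + v.norm := fun t =>
    hv.exists_near (c := 0) (by simpa using hnot h _ (hM t).2)
  choose k hkp hkn using hk
  choose l hlp hln using hl
  have hball : ∀ t, ((g * u ^ k t)⁻¹ * (h * v ^ l t)).norm ≤ u.norm + v.norm := by
    intro t
    have h₁ := norm_inv_mk_mul_le (hkp t)
    have h₂ := norm_inv_mk_mul_le (hlp t)
    rw [List.length_ofFn] at h₁ h₂
    set p := FreeGroup.mk (List.ofFn fun i : Fin (M t) => ξ.1 i)
    have h₃ := FreeGroup.norm_mul_le (p⁻¹ * (g * u ^ k t))⁻¹ (p⁻¹ * (h * v ^ l t))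
    rw [FreeGroup.norm_inv_eq, mul_inv_rev p⁻¹, inv_inv, mul_assoc, mul_inv_cancel_left] at h₃
    have := hkn t
    have := hln t
    omega
  have := (finite_norm_le (B := B) (u.norm + v.norm)).to_subtype
  obtain ⟨s, t, hst, heq⟩ := Finite.exists_ne_map_eq_of_infinite
    fun t : ℕ => (⟨_, hball t⟩ : {x : FreeGroup B | x.norm ≤ u.norm + v.norm})
  have heq' : (g * u ^ k s)⁻¹ * (h * v ^ l s) = (g * u ^ k t)⁻¹ * (h * v ^ l t) :=
    congrArg Subtype.val heq
  have hlt : ∀ s t, s < t → g * u ^ k s ≠ g * u ^ k t := by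
    intro s t hst he
    have h₁ := hkn s
    have h₂ := (hkp t).length_le
    rw [List.length_ofFn] at h₂
    change M t ≤ (g * u ^ k t).norm at h₂
    rw [← he] at h₂
    have h₃ : (u.norm + 1) * (s + 1) ≤ (u.norm + 1) * t := Nat.mul_le_mul_left _ hst
    simp only [M] at h₁ h₂
    rw [mul_add] at h₃
    omega
  have hne : g * u ^ k s ≠ g * u ^ k t := by
    rcases lt_or_gt_of_ne hst with h | h
    · exact hlt s t h
    · exact (hlt t s h).symm
  refine ⟨k t - k s, l t - l s, fun h1 => hne ?_, ?_⟩
  · rw [zpow_sub, mul_inv_eq_one] at h1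
    rw [h1]
  · have h4 : (h * v ^ l s) = (g * u ^ k s) * ((g * u ^ k t)⁻¹ * (h * v ^ l t)) := by
      rw [← heq', mul_inv_cancel_left]
    have h5 : (h * v ^ l t) * (h * v ^ l s)⁻¹ = (g * u ^ k t) * (g * u ^ k s)⁻¹ := by
      rw [h4]
      group
    rw [zpow_sub, zpow_sub]
    simpa only [mul_assoc, mul_inv_rev] using h5.symm

variable {r : ℕ} {w : Fin r → FreeGroup B}

theorem IsLine.symm {ξ η : Boundary B} (h : IsLine B w ξ η) : IsLine B w η ξ := by
  obtain ⟨g, i, h⟩ := h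
  exact ⟨g, i, h.symm⟩

/-- A line is an orbit line of a generator or of its inverse. -/
theorem isLine_iff {ξ η : Boundary B} : IsLine B w ξ η ↔ ∃ (g : FreeGroup B) (i : Fin r)
    (u : FreeGroup B), (u = w i ∨ u = (w i)⁻¹) ∧ TendstoBoundary B (fun k => g * u ^ k) ξ ∧
      TendstoBoundary B (fun k => g * u⁻¹ ^ k) η := by
  constructor
  · rintro ⟨g, i, ⟨h₁, h₂⟩ | ⟨h₁, h₂⟩⟩
    · exact ⟨g, i, _, .inl rfl, h₁, h₂⟩
    · exact ⟨g, i, _, .inr rfl, h₂, by simpa using h₁⟩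
  · rintro ⟨g, i, _, rfl | rfl, h₁, h₂⟩
    · exact ⟨g, i, .inl ⟨h₁, h₂⟩⟩
    · exact ⟨g, i, .inr ⟨by simpa using h₂, h₁⟩⟩

/-- Distinct lines of a malnormal pattern have disjoint endpoints. -/
theorem IsLine.eq_of_common_endpoint [Finite B] (hmal : Malnormal B w) {ξ η ζ : Boundary B}
    (h₁ : IsLine B w ξ η) (h₂ : IsLine B w ξ ζ) : η = ζ := by
  obtain ⟨g, i, u, hu, hgξ, hgη⟩ := isLine_iff.1 h₁
  obtain ⟨h, j, v, hv, hhξ, hhζ⟩ := isLine_iff.1 h₂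
  obtain ⟨a, b, ha, hab⟩ := exists_conj_zpow_eq hgξ hhξ
  have hmem : ∀ {i u} (_ : u = w i ∨ u = (w i)⁻¹) (a : ℤ), u ^ a ∈ Subgroup.zpowers (w i) := by
    rintro i _ (rfl | rfl) a
    · exact Subgroup.zpow_mem _ (Subgroup.mem_zpowers _) _
    · exact Subgroup.zpow_mem _ (Subgroup.inv_mem _ (Subgroup.mem_zpowers _)) _
  obtain ⟨rfl, hgh⟩ := hmal (h⁻¹ * g) i j ⟨u ^ a, hmem hu a, ha, by
    have : h⁻¹ * g * u ^ a * (h⁻¹ * g)⁻¹ = h⁻¹ * (g * u ^ a * g⁻¹) * h := by group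
    rw [this, hab]
    simpa [mul_assoc] using hmem hv b⟩
  obtain ⟨c, hc⟩ : ∃ c : ℤ, g = h * v ^ c := by
    obtain ⟨c, hc⟩ := hgh
    have hc' : w i ^ c = h⁻¹ * g := hc
    rcases hv with rfl | rfl
    · exact ⟨c, by rw [hc', mul_inv_cancel_left]⟩
    · exact ⟨-c, by rw [inv_zpow', neg_neg, hc', mul_inv_cancel_left]⟩
  have hξ' : TendstoBoundary B (fun k => g * v ^ k) ξ := hc ▸ hhξ.mul_zpow c
  have hζ' : TendstoBoundary B (fun k => g * v⁻¹ ^ k) ζ := by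
    have := hhζ.mul_zpow (-c)
    rwa [inv_zpow', neg_neg, ← hc] at this
  have huv : u = v ∨ u = v⁻¹ := by
    rcases hu with rfl | rfl <;> rcases hv with rfl | rfl <;> simp
  rcases huv with rfl | rfl
  · exact hgη.eq hζ'
  · exact (hgη.eq (by simpa using hξ')).trans (hgξ.eq hζ')

/-- Only finitely many lines have endpoints which differ among their first `M` letters. -/
theorem finite_setOf_isLine [Finite B] (w : Fin r → FreeGroup B) (M : ℕ) :
    {p : Boundary B × Boundary B | IsLine B w p.1 p.2 ∧ ∃ n < M, p.1.1 n ≠ p.2.1 n}.Finite := by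
  obtain ⟨C, hC⟩ : ∃ C, ∀ i, (w i).norm ≤ C := by
    obtain ⟨C, hC⟩ := (Set.finite_range fun i => (w i).norm).bddAbove
    exact ⟨C, fun i => hC ⟨i, rfl⟩⟩
  let S : FreeGroup B × FreeGroup B → Set (Boundary B × Boundary B) := fun q =>
    {p | TendstoBoundary B (fun k => q.1 * q.2 ^ k) p.1 ∧
      TendstoBoundary B (fun k => q.1 * q.2⁻¹ ^ k) p.2}
  have hS : ∀ q, (S q).Finite := fun q => Set.Subsingleton.finite fun p hp p' hp' =>
    Prod.ext (hp.1.eq hp'.1) (hp.2.eq hp'.2)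
  refine (((finite_norm_le (B := B) (M + C)).prod (finite_norm_le (B := B) C)).biUnion
    fun q _ => hS q).subset ?_
  rintro ⟨ξ, η⟩ ⟨hline, n, hn, hne⟩
  obtain ⟨g, i, u, hu, hξ, hη⟩ := isLine_iff.1 hline
  have huC : u.norm ≤ C := by
    rcases hu with rfl | rfl
    · exact hC i
    · exact FreeGroup.norm_inv_eq.trans_le (hC i)
  obtain ⟨K, hK⟩ := hη M
  obtain ⟨k, -, hk⟩ := hξ.exists_near (m := M) (c := -K) fun hp => hne (by
    have hq : _ <+: (g * u⁻¹ ^ K).toWord := hK K le_rfl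
    rw [inv_pow, ← zpow_natCast, ← zpow_neg] at hq
    have := (List.prefix_of_prefix_length_le hp hq (by simp)).eq_of_length (by simp)
    exact congrFun (List.ofFn_injective this) ⟨n, hn⟩)
  refine Set.mem_biUnion (x := (g * u ^ k, u)) ⟨hk.trans (by simpa using huC), huC⟩ ⟨?_, ?_⟩
  · exact hξ.mul_zpow k
  · simpa using hη.mul_zpow (-k)

end Lines

section DecompositionSpace

variable {B : Type} [DecidableEq B]

instance : DiscreteTopology (B × Bool) := ⟨rfl⟩

instance [Finite B] : CompactSpace (Boundary B) := by
  refine isCompact_iff_compactSpace.1 (IsClosed.isCompact ?_)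
  change IsClosed {s : ℕ → B × Bool | ∀ k, s (k + 1) ≠ ((s k).1, !(s k).2)}
  rw [Set.ofPred_forall]
  refine isClosed_iInter fun k => ?_
  have hc : Continuous fun s : ℕ → B × Bool => (s (k + 1), s k) :=
    (continuous_apply _).prodMk (continuous_apply _)
  exact (isClosed_discrete {q : (B × Bool) × (B × Bool) | q.1 ≠ (q.2.1, !q.2.2)}).preimage hc

variable {r : ℕ} {w : Fin r → FreeGroup B}

theorem qmap_eq_iff [Finite B] (hmal : Malnormal B w) {ξ η : Boundary B} :
    qmap B w ξ = qmap B w η ↔ ξ = η ∨ IsLine B w ξ η := by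
  have hequiv : Equivalence fun ξ η : Boundary B => ξ = η ∨ IsLine B w ξ η := by
    refine ⟨fun _ => .inl rfl, ?_, ?_⟩
    · rintro _ _ (rfl | h)
      · exact .inl rfl
      · exact .inr h.symm
    · rintro _ _ _ (rfl | h) (rfl | h')
      · exact .inl rfl
      · exact .inr h'
      · exact .inr h
      · exact .inl (h.symm.eq_of_common_endpoint hmal h')
  constructor
  · intro h
    have hgen := Quot.eqvGen_exact h
    clear h
    induction hgen with
    | rel _ _ h => exact .inr h
    | refl _ => exact hequiv.refl _
    | symm _ _ _ ih => exact hequiv.symm ih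
    | trans _ _ _ _ _ ih ih' => exact hequiv.trans ih ih'
  · rintro (rfl | h)
    · rfl
    · exact Quot.sound h

theorem isClosedMap_qmap [Finite B] (hmal : Malnormal B w) : IsClosedMap (qmap B w) := by
  refine isClosedMap_of_isClosed_ker (f := qmap B w) isQuotientMap_quot_mk ?_
  refine isOpen_compl_iff.1 (isOpen_iff_mem_nhds.2 ?_)
  rintro ⟨ξ, η⟩ hp
  have hp' : ¬ (ξ = η ∨ IsLine B w ξ η) := fun h => hp ((qmap_eq_iff hmal).2 h)
  obtain ⟨n, hn⟩ : ∃ n, ξ.1 n ≠ η.1 n := by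
    by_contra! h
    exact hp' (.inl (Subtype.ext (funext h)))
  have hO : IsOpen {p : Boundary B × Boundary B | p.1.1 n ≠ p.2.1 n} := by
    have hc : Continuous fun p : Boundary B × Boundary B => (p.1.1 n, p.2.1 n) :=
      ((continuous_apply n).comp (continuous_subtype_val.comp continuous_fst)).prodMk
        ((continuous_apply n).comp (continuous_subtype_val.comp continuous_snd))
    exact (isOpen_discrete {q : (B × Bool) × (B × Bool) | q.1 ≠ q.2}).preimage hc
  have hN := (finite_setOf_isLine w (n + 1)).isClosed.isOpen_compl
  refine Filter.mem_of_superset ((hO.inter hN).mem_nhds ⟨hn, fun h => hp' (.inr h.1)⟩) ?_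
  rintro ⟨ξ', η'⟩ ⟨hne, hnot⟩ heq
  rcases (qmap_eq_iff hmal).1 heq with h | h
  · exact hne (by rw [show ξ' = η' from h])
  · exact hnot ⟨h, n, n.lt_succ_self, hne⟩

end DecompositionSpace

end DecompPaper

open DecompPaper
/-- every finite open cover of the decomposition space `D` admits a
finite open refinement covering `D` with no nonempty triple intersections. -/
theorem decomposition_space_refinement_no_triple_intersections
    (B : Type) [Fintype B] [DecidableEq B] (hB : 2 ≤ Fintype.card B)
    (r : ℕ) (w : Fin r → FreeGroup B) (hw : ∀ i, w i ≠ 1) (hmal : Malnormal B w)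
    (W : Set (Set (DSpace B w))) (hWfin : W.Finite)
    (hWopen : ∀ V ∈ W, IsOpen V) (hWcov : ⋃₀ W = Set.univ) :
    ∃ V : Set (Set (DSpace B w)), V.Finite ∧ (∀ u ∈ V, IsOpen u) ∧
      ⋃₀ V = Set.univ ∧
      (∀ u ∈ V, ∃ s ∈ W, u ⊆ s) ∧
      (∀ u ∈ V, ∀ v ∈ V, ∀ t ∈ V, u ≠ v → v ≠ t → u ≠ t → u ∩ v ∩ t = ∅) := by
  refine exists_refinement_of_isClosedMap (isClosedMap_qmap hmal) continuous_quot_mk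
    Quot.mk_surjective (fun ξ η ζ h₁ h₂ => ?_) W hWopen hWcov
  rcases (qmap_eq_iff hmal).1 h₁ with h₁ | h₁
  · exact .inl h₁
  rcases (qmap_eq_iff hmal).1 h₂ with h₂ | h₂
  · exact .inr (.inl h₂)
  · exact .inr (.inr (h₁.symm.eq_of_common_endpoint hmal h₂))
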